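/- Let 2 ≤ m ≤ n be integers with m + n > 4, and set z_{ab} = (a,b)_m and z_{bc} = (b,c)_n in A(P_3^{m,n}). Then the subgroup of A(P_3^{m,n}) generated by z_{ab}², b², z_{bc}², c² is isomorphic to the right-angled Artin group A(P_4), via an isomorphism sending the consecutive path generators of A(P_4) to z_{ab}², b², z_{bc}², c² respectively; in particular A(P_4) embeds into A(P_3^{m,n}). -/

import Mathlib

/-- The alternating product `u v u v …` of length `m`. -/
def altProd {G : Type*} [Monoid G] (u v : G) (m : ℕ) : G :=
  ((List.range m).map (fun i => if i % 2 = 0 then u else v)).prod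

/-- Relations of the Artin group of an Artin graph `(G, ℓ)`:
`(u,v)_{ℓ u v} = (v,u)_{ℓ u v}` for each edge `{u,v}`. -/
def artinRels {V : Type*} (G : SimpleGraph V) (ℓ : V → V → ℕ) : Set (FreeGroup V) :=
  {r | ∃ u v : V, G.Adj u v ∧
    r = altProd (FreeGroup.of u) (FreeGroup.of v) (ℓ u v) *
        (altProd (FreeGroup.of v) (FreeGroup.of u) (ℓ u v))⁻¹}

/-- The Artin group of an Artin graph `(G, ℓ)`. -/
abbrev ArtinGroup {V : Type*} (G : SimpleGraph V) (ℓ : V → V → ℕ) :=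
  PresentedGroup (artinRels G ℓ)

/-- Relations of the right-angled Artin group of a simplicial graph: commutators of adjacent vertices. -/
def raagRels {V : Type*} (G : SimpleGraph V) : Set (FreeGroup V) :=
  {r | ∃ u v : V, G.Adj u v ∧
    r = FreeGroup.of u * FreeGroup.of v * (FreeGroup.of u)⁻¹ * (FreeGroup.of v)⁻¹}

/-- The right-angled Artin group of a simplicial graph. -/
abbrev RAAG {V : Type*} (G : SimpleGraph V) := PresentedGroup (raagRels G)

/-- Labels for the path `P₃^{m,n}` on vertices `a = 0, b = 1, c = 2`: the edge `{a, b}` is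
labeled `m` and the edge `{b, c}` is labeled `n`. -/
def P3Label (m n : ℕ) : Fin 3 → Fin 3 → ℕ := fun i j =>
  if (i = 0 ∧ j = 1) ∨ (i = 1 ∧ j = 0) then m else n

open Monoid in
theorem pushout_map_inj {ι : Type} {G G' : ι → Type} {H H' : Type}
    [∀ i, Group (G i)] [∀ i, Group (G' i)] [Group H] [Group H']
    (φ : ∀ i, H →* G i) (φ' : ∀ i, H' →* G' i)
    (hφ : ∀ i, Function.Injective (φ i)) (hφ' : ∀ i, Function.Injective (φ' i))
    (ψ : ∀ i, G i →* G' i) (η : H →* H') (hη : Function.Injective η)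
    (hinter : ∀ i g, ψ i g ∈ (φ' i).range → g ∈ (φ i).range)
    (F : PushoutI φ →* PushoutI φ')
    (hF : ∀ i g, F (PushoutI.of i g) = PushoutI.of i (ψ i g))
    (hFb : ∀ h, F (PushoutI.base φ h) = PushoutI.base φ' (η h)) :
    Function.Injective F := by
  classical
  rw [injective_iff_map_eq_one]
  intro x hx
  obtain ⟨d⟩ := PushoutI.NormalWord.transversal_nonempty φ hφ
  obtain ⟨v, hv⟩ : ∃ v : PushoutI.NormalWord d, v.prod = x :=
    ⟨x • PushoutI.NormalWord.empty, by rw [PushoutI.NormalWord.prod_smul]; simp⟩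
  have hnot : ∀ g ∈ v.toList, g.2 ∉ (φ g.1).range := by
    rintro ⟨i, g⟩ hg hr
    have hs := v.normalized i g hg
    have h1 := v.ne_one _ hg
    apply h1
    have := (d.compl i).1 (a₁ := (⟨g, hr⟩, ⟨1, d.one_mem i⟩)) (a₂ := (1, ⟨g, hs⟩)) (by simp)
    simpa using congrArg (fun z => (z.1 : G i)) this
  let w' : CoprodI.Word G' :=
    { toList := v.toList.map (fun g => ⟨g.1, ψ g.1 g.2⟩)
      ne_one := by
        intro l hl
        rw [List.mem_map] at hl
        obtain ⟨g, hg, rfl⟩ := hl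
        intro h1
        exact hnot g hg (hinter _ _ (by simp only at h1; rw [h1]; exact one_mem _))
      chain_ne := by
        rw [List.isChain_map]
        exact v.chain_ne }
  have hred : PushoutI.Reduced φ' w' := by
    intro l hl
    simp only [w', List.mem_map] at hl
    obtain ⟨g, hg, rfl⟩ := hl
    exact fun h => hnot g hg (hinter _ _ h)
  have hprod : F (PushoutI.ofCoprodI v.toWord.prod) = PushoutI.ofCoprodI w'.prod := by
    simp only [CoprodI.Word.prod, map_list_prod, List.map_map, w']
    congr 1
    apply List.map_congr_left
    intro g _
    simp [hF]
  have hx' : PushoutI.base φ' (η v.head) * PushoutI.ofCoprodI w'.prod = 1 := by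
    rw [← hprod, ← hFb, ← map_mul, ← hx, ← hv]; rfl
  have hemp := hred.eq_empty_of_mem_range hφ' ⟨(η v.head)⁻¹, by
    rw [map_inv]; exact inv_eq_of_mul_eq_one_right hx'⟩
  rw [hemp] at hx'
  have h2 : v.head = 1 := by
    apply hη
    apply PushoutI.base_injective hφ'
    simpa using hx'
  have h3 : v.toWord = CoprodI.Word.empty := by
    have := congrArg CoprodI.Word.toList hemp
    simp only [w', CoprodI.Word.empty, List.map_eq_nil_iff] at this
    ext1
    exact this
  rw [← hv, PushoutI.NormalWord.prod, h2, h3]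
  simp

theorem altProd_succ {G : Type*} [Monoid G] (u v : G) (m : ℕ) :
    altProd u v (m+1) = altProd u v m * (if m % 2 = 0 then u else v) := by
  simp [altProd, List.range_succ]

theorem altProd_succ' {G : Type*} [Monoid G] (u v : G) (m : ℕ) :
    altProd u v (m+1) = u * altProd v u m := by
  induction m generalizing u v with
  | zero => simp [altProd]
  | succ m ih =>
    rw [altProd_succ, ih, altProd_succ v u m, mul_assoc]
    congr 2
    rcases Nat.mod_two_eq_zero_or_one m with h | h
    · rw [if_neg (by omega), if_pos h]
    · rw [if_pos (by omega), if_neg (by omega)]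

theorem map_altProd {G K : Type*} [Monoid G] [Monoid K] (f : G →* K) (u v : G) (m : ℕ) :
    f (altProd u v m) = altProd (f u) (f v) m := by
  induction m with
  | zero => simp [altProd]
  | succ m ih => rw [altProd_succ, altProd_succ, map_mul, ih]; split_ifs <;> rfl

theorem altProd_comm {G : Type*} [Monoid G] (u v : G) (m : ℕ)
    (h : altProd u v m = altProd v u m) :
    Commute ((altProd u v m)^2) u ∧ Commute ((altProd u v m)^2) v := by
  have h1 : u * altProd u v m = altProd u v m * (if m % 2 = 0 then u else v) := by
    rw [← altProd_succ, altProd_succ', h]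
  have h2 : v * altProd u v m = altProd u v m * (if m % 2 = 0 then v else u) := by
    rw [← altProd_succ', h, altProd_succ]
  generalize altProd u v m = z at h1 h2
  rcases Nat.mod_two_eq_zero_or_one m with h | h
  · rw [if_pos h] at h1 h2
    exact ⟨Commute.pow_left h1.symm 2, Commute.pow_left h2.symm 2⟩
  · rw [if_neg (by omega)] at h1 h2
    constructor
    · show z^2 * u = u * z^2
      rw [pow_two, ← mul_assoc, h1, mul_assoc, ← h2, mul_assoc]
    · show z^2 * v = v * z^2
      rw [pow_two, ← mul_assoc, h2, mul_assoc, ← h1, mul_assoc]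

abbrev SL2R := Matrix.SpecialLinearGroup (Fin 2) ℝ

noncomputable def upp (x : ℝ) : SL2R := ⟨!![1, x; 0, 1], by simp⟩
noncomputable def low (x : ℝ) : SL2R := ⟨!![1, 0; -x, 1], by simp⟩
noncomputable def jj : SL2R := ⟨!![0, 1; -1, 0], by simp⟩

theorem upp_c (x : ℝ) : (upp x : Matrix (Fin 2) (Fin 2) ℝ) = !![1, x; 0, 1] := rfl
theorem low_c (x : ℝ) : (low x : Matrix (Fin 2) (Fin 2) ℝ) = !![1, 0; -x, 1] := rfl
theorem jj_c : (jj : Matrix (Fin 2) (Fin 2) ℝ) = !![0, 1; -1, 0] := rfl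

theorem upp_mul (x y : ℝ) : upp x * upp y = upp (x + y) := by
  ext i j; fin_cases i <;> fin_cases j <;> simp [upp_c, add_comm]

theorem low_mul (x y : ℝ) : low x * low y = low (x + y) := by
  ext i j; fin_cases i <;> fin_cases j <;> simp [low_c, add_comm]

theorem upp_zpow (x : ℝ) (k : ℤ) : upp x ^ k = upp (k * x) := by
  let h : Multiplicative ℝ →* SL2R :=
    { toFun := fun t => upp (Multiplicative.toAdd t)
      map_one' := by ext i j; fin_cases i <;> fin_cases j <;> simp [upp_c]
      map_mul' := fun a b => by simp [upp_mul] }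
  have := map_zpow h (Multiplicative.ofAdd x) k
  simpa [h] using this.symm

theorem jj_sq : jj * jj = -1 := by
  ext i j; fin_cases i <;> fin_cases j <;> simp [jj_c]

theorem jj_conj (x : ℝ) : jj * upp x = low x * jj := by
  ext i j; fin_cases i <;> fin_cases j <;> simp [jj_c, upp_c, low_c]

theorem jj_conj' (x : ℝ) : jj * low x = upp x * jj := by
  ext i j; fin_cases i <;> fin_cases j <;> simp [jj_c, upp_c, low_c]

theorem trig_pow (θ : ℝ) (k : ℕ) :
    Real.sin θ • (!![-(2 * Real.cos θ), 1; -1, 0] : Matrix (Fin 2) (Fin 2) ℝ) ^ k =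
      (-1 : ℝ) ^ k • !![Real.sin ((k + 1) * θ), -Real.sin (k * θ);
        Real.sin (k * θ), -Real.sin ((k - 1) * θ)] := by
  induction k with
  | zero =>
    ext i j; fin_cases i <;> fin_cases j <;> simp
  | succ k ih =>
    have e1 : Real.sin ((k + 1 + 1) * θ) =
        2 * Real.cos θ * Real.sin ((k + 1) * θ) - Real.sin (k * θ) := by
      have h1 : ((k : ℝ) + 1 + 1) * θ = (k + 1) * θ + θ := by ring
      have h2 : (k : ℝ) * θ = (k + 1) * θ - θ := by ring
      rw [h1, h2, Real.sin_add, Real.sin_sub]; ring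
    have e2 : Real.sin ((k + 1) * θ) =
        2 * Real.cos θ * Real.sin (k * θ) - Real.sin ((k - 1) * θ) := by
      have h1 : ((k : ℝ) + 1) * θ = k * θ + θ := by ring
      have h2 : ((k : ℝ) - 1) * θ = k * θ - θ := by ring
      rw [h1, h2, Real.sin_add, Real.sin_sub]; ring
    rw [pow_succ, ← Matrix.smul_mul, ih]
    push_cast
    rw [e1]
    ext i j; fin_cases i <;> fin_cases j <;> simp [pow_succ] <;>
      first
      | linear_combination ((-1 : ℝ)^k) * e2
      | linear_combination (-(-1 : ℝ)^k) * e2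
      | linear_combination (0 : ℝ) * e2

theorem trig_pow_n (n : ℕ) (hn : 3 ≤ n) :
    (upp (2 * Real.cos (Real.pi / n)) * jj) ^ n = (-1) ^ (n + 1) := by
  have hn0 : (n : ℝ) ≠ 0 := by positivity
  have h := trig_pow (Real.pi / n) n
  have e0 : (n : ℝ) * (Real.pi / n) = Real.pi := by field_simp
  have e1 : ((n : ℝ) + 1) * (Real.pi / n) = Real.pi + Real.pi / n := by field_simp
  have e2 : ((n : ℝ) - 1) * (Real.pi / n) = Real.pi - Real.pi / n := by field_simp
  have hs : Real.sin (Real.pi / n) ≠ 0 := by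
    apply ne_of_gt
    apply Real.sin_pos_of_pos_of_lt_pi
    · positivity
    · apply div_lt_self Real.pi_pos
      exact_mod_cast (by omega : 1 < n)
  rw [e0, e1, e2, Real.sin_pi_sub, Real.sin_pi] at h
  have e3 : Real.sin (Real.pi + Real.pi / n) = - Real.sin (Real.pi / n) := by
    rw [add_comm, Real.sin_add_pi]
  rw [e3] at h
  have hc : ((upp (2 * Real.cos (Real.pi / n)) * jj : SL2R) : Matrix (Fin 2) (Fin 2) ℝ) =
      !![-(2 * Real.cos (Real.pi / n)), 1; -1, 0] := by
    ext i j; fin_cases i <;> fin_cases j <;> simp [upp_c, jj_c]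
  apply Subtype.ext
  rw [Matrix.SpecialLinearGroup.coe_pow, hc]
  have h4 : Real.sin (Real.pi / n) •
      (!![-(2 * Real.cos (Real.pi / n)), 1; -1, 0] : Matrix (Fin 2) (Fin 2) ℝ) ^ n
      = Real.sin (Real.pi / n) • (((-1 : SL2R) ^ (n + 1) : SL2R) : Matrix (Fin 2) (Fin 2) ℝ) := by
    rw [h]
    rcases neg_one_pow_eq_or ℝ n with h5 | h5 <;> rcases Nat.even_or_odd n with h6 | h6 <;>
    · ext i j; fin_cases i <;> fin_cases j <;> simp [pow_succ, h6]
  exact smul_right_injective _ hs h4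

theorem alt_upp_low (x : ℝ) (k : ℕ) :
    altProd (upp x) (low x) k * jj ^ k = (upp x * jj) ^ k := by
  have key : ∀ k : ℕ, (if k % 2 = 0 then upp x else low x) * jj ^ k = jj ^ k * upp x := by
    intro k
    rcases Nat.even_or_odd' k with ⟨c, rfl | rfl⟩
    · rw [if_pos (by omega), pow_mul, pow_two, jj_sq]
      rcases neg_one_pow_eq_or SL2R c with h | h <;> simp [h]
    · rw [if_neg (by omega), pow_succ, pow_mul, pow_two, jj_sq]
      rcases neg_one_pow_eq_or SL2R c with h | h <;> simp [h, jj_conj]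
  induction k with
  | zero => simp [altProd]
  | succ k ih =>
    rw [altProd_succ, pow_succ (jj), pow_succ (upp x * jj), ← ih]
    have := key k
    calc _ = altProd (upp x) (low x) k *
          ((if k % 2 = 0 then upp x else low x) * jj ^ k) * jj := by simp only [mul_assoc]
      _ = _ := by rw [this]; simp only [mul_assoc]

theorem negone_zpowers {g : SL2R} (h : g ∈ Subgroup.zpowers (-1 : SL2R)) : g = 1 ∨ g = -1 := by
  obtain ⟨k, rfl⟩ := h
  rcases Int.even_or_odd k with h | h
  · left; exact h.neg_one_zpow
  · right; exact h.neg_one_zpow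

theorem braid_upp_low (n : ℕ) (hn : 3 ≤ n) (x : ℝ) (hx : x = 2 * Real.cos (Real.pi / n)) :
    altProd (upp x) (low x) n = altProd (low x) (upp x) n ∧
    (altProd (upp x) (low x) n) ^ 2 ∈ Subgroup.zpowers (-1 : SL2R) := by
  have h1 := alt_upp_low x n
  rw [show (upp x * jj) ^ n = (-1) ^ (n + 1) by rw [hx]; exact trig_pow_n n hn] at h1
  have h2 : altProd (upp x) (low x) n = (-1) ^ (n+1) * (jj ^ n)⁻¹ := eq_mul_inv_of_mul_eq h1
  have hcen : ∀ g : SL2R, Commute ((-1 : SL2R) ^ (n+1)) g := fun g => by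
    rcases neg_one_pow_eq_or SL2R (n+1) with h | h <;> simp [h]
  constructor
  · have h3 := map_altProd (MulAut.conj jj).toMonoidHom (upp x) (low x) n
    have c1 : (MulAut.conj jj).toMonoidHom (upp x) = low x := by simp [jj_conj]
    have c2 : (MulAut.conj jj).toMonoidHom (low x) = upp x := by simp [jj_conj']
    rw [c1, c2] at h3
    rw [← h3]
    have : Commute jj (altProd (upp x) (low x) n) := by
      rw [h2]
      exact (hcen jj).symm.mul_right ((Commute.refl jj).pow_right n).inv_right
    simp only [MulEquiv.toMonoidHom_eq_coe, MonoidHom.coe_coe, MulAut.conj_apply]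
    rw [this.eq, mul_inv_cancel_right]
  · rw [h2, (hcen _).mul_pow, ← inv_pow, ← pow_mul, ← pow_mul, mul_comm n 2, pow_mul _ 2 n, pow_two,
      ← mul_inv_rev, jj_sq]
    exact mul_mem (pow_mem (Subgroup.mem_zpowers _) _)
      (pow_mem (inv_mem (Subgroup.mem_zpowers _)) _)

theorem step_diff (t y l : ℝ) (hl : 1 ≤ l) (h : y ^ 2 < t ^ 2) :
    t ^ 2 < (y - 2 * l * t) ^ 2 ∧ t * (y - 2 * l * t) < 0 := by
  have h1 : 0 < t ^ 2 - t * y := by nlinarith [sq_nonneg (t - y)]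
  constructor
  · nlinarith [sq_nonneg (y - t), mul_pos (by linarith : (0:ℝ) < 4 * l - 2) h1,
      mul_nonneg (mul_nonneg (by linarith : (0:ℝ) ≤ l) (by linarith : (0:ℝ) ≤ l - 1)) (sq_nonneg t)]
  · nlinarith [mul_nonneg (by linarith : (0:ℝ) ≤ l - 1) (sq_nonneg t), sq_nonneg t]

theorem step_same (t y l : ℝ) (hl : 1 ≤ l) (h : t ^ 2 < y ^ 2) (h' : t * y < 0) :
    t ^ 2 < (y - 2 * l * t) ^ 2 ∧ t * (y - 2 * l * t) < 0 := by
  have h1 := mul_neg_of_pos_of_neg (by linarith : 0 < l) h'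
  constructor
  · nlinarith [sq_nonneg (l * t)]
  · nlinarith [mul_nonneg (by linarith : (0:ℝ) ≤ l) (sq_nonneg t)]

/-- sign of a letter -/
def sgn (e : Bool) : ℝ := if e then 1 else -1

theorem sgn_sq (e : Bool) : sgn e * sgn e = 1 := by cases e <;> simp [sgn]

/-- The first column after letter `(1,e)`. -/
def PPstate (L : List (Fin 2 × Bool)) (x y : ℝ) : Prop :=
  ((∀ g ∈ L, g.1 = 0) ∧ x = 1 ∧ y = 0) ∨
  ∃ e L', (L = (1, e) :: L' ∧ x ^ 2 < y ^ 2 ∧ (sgn e * x) * y < 0) ∨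
    (L = (0, e) :: L' ∧ y ^ 2 < x ^ 2 ∧ (- (sgn e * y)) * x < 0)

theorem pp_cons_one (l : ℝ) (hl : 1 ≤ l) (e : Bool) (L : List (Fin 2 × Bool))
    (hL : FreeGroup.IsReduced ((1, e) :: L)) (x y : ℝ) (h : PPstate L x y) :
    PPstate ((1, e) :: L) x (y - 2 * l * (sgn e * x)) := by
  have hsq : (sgn e * x) ^ 2 = x ^ 2 := by rw [mul_pow, pow_two (sgn e), sgn_sq, one_mul]
  refine Or.inr ⟨e, L, Or.inl ⟨rfl, ?_⟩⟩
  rw [← hsq]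
  rcases h with ⟨_, rfl, rfl⟩ | ⟨e', L', ⟨rfl, h1, h2⟩ | ⟨rfl, h1, h2⟩⟩
  · exact step_diff _ _ l hl (by rw [hsq]; norm_num)
  · rw [FreeGroup.isReduced_cons_cons] at hL
    have : e = e' := hL.1 rfl
    subst this
    exact step_same _ _ l hl (by rwa [hsq]) h2
  · exact step_diff _ _ l hl (by rwa [hsq])

theorem pp_cons_zero (l : ℝ) (hl : 1 ≤ l) (e : Bool) (L : List (Fin 2 × Bool))
    (hL : FreeGroup.IsReduced ((0, e) :: L)) (x y : ℝ) (h : PPstate L x y) :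
    PPstate ((0, e) :: L) (x - 2 * l * (-(sgn e * y))) y := by
  have hsq : (-(sgn e * y)) ^ 2 = y ^ 2 := by
    rw [neg_sq, mul_pow, pow_two (sgn e), sgn_sq, one_mul]
  rcases h with ⟨h, rfl, rfl⟩ | ⟨e', L', ⟨rfl, h1, h2⟩ | ⟨rfl, h1, h2⟩⟩
  · left
    refine ⟨?_, by simp, rfl⟩
    intro g hg
    rcases List.mem_cons.1 hg with rfl | hg
    · rfl
    · exact h g hg
  · refine Or.inr ⟨e, _, Or.inr ⟨rfl, ?_⟩⟩
    rw [← hsq]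
    have := step_diff _ _ l hl (hsq.symm ▸ h1)
    exact ⟨by simpa only [hsq] using this.1, this.2⟩
  · rw [FreeGroup.isReduced_cons_cons] at hL
    have : e = e' := hL.1 rfl
    subst this
    refine Or.inr ⟨e, _, Or.inr ⟨rfl, ?_⟩⟩
    have := step_same _ _ l hl (hsq.symm ▸ h1) h2
    exact ⟨by simpa only [hsq] using this.1, this.2⟩

theorem upp_inv (x : ℝ) : (upp x)⁻¹ = upp (-x) := by
  rw [inv_eq_iff_mul_eq_one, upp_mul]
  ext i j; fin_cases i <;> fin_cases j <;> simp [upp_c]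

theorem low_inv (x : ℝ) : (low x)⁻¹ = low (-x) := by
  rw [inv_eq_iff_mul_eq_one, low_mul]
  ext i j; fin_cases i <;> fin_cases j <;> simp [low_c]

theorem pp_main (l : ℝ) (hl : 1 ≤ l) (L : List (Fin 2 × Bool)) (hL : FreeGroup.IsReduced L) :
    PPstate L
      ((FreeGroup.lift ![upp l ^ 2, low l ^ 2] (FreeGroup.mk L) : SL2R) 0 0)
      ((FreeGroup.lift ![upp l ^ 2, low l ^ 2] (FreeGroup.mk L) : SL2R) 1 0) := by
  induction L with
  | nil => left; simp
  | cons g L ih =>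
    have ih := ih (hL.infix (List.suffix_cons _ _).isInfix)
    rw [show FreeGroup.mk (g :: L) = FreeGroup.mk [g] * FreeGroup.mk L by
      rw [FreeGroup.mul_mk]; rfl, map_mul]
    generalize FreeGroup.lift ![upp l ^ 2, low l ^ 2] (FreeGroup.mk L) = M at ih
    obtain ⟨i, e⟩ := g
    fin_cases i
    · have := pp_cons_zero l hl e L hL _ _ ih
      convert this using 1 <;> cases e <;>
        simp [pow_two, upp_mul, upp_inv, upp_c, sgn, Matrix.mul_apply] <;> ring_nf <;> simp
    · have := pp_cons_one l hl e L hL _ _ ih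
      convert this using 1 <;> cases e <;>
        simp [pow_two, low_mul, low_inv, low_c, sgn, Matrix.mul_apply] <;> ring_nf <;> simp

theorem zpow_of_all_zero (L : List (Fin 2 × Bool)) (h : ∀ g ∈ L, g.1 = 0) :
    ∃ l : ℤ, FreeGroup.mk L = FreeGroup.of (0 : Fin 2) ^ l := by
  induction L with
  | nil => exact ⟨0, rfl⟩
  | cons g L ih =>
    obtain ⟨l, hl⟩ := ih fun g hg => h g (List.mem_cons_of_mem _ hg)
    have h0 := h g List.mem_cons_self
    obtain ⟨i, e⟩ := g
    simp only at h0
    subst h0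
    rw [show FreeGroup.mk ((0, e) :: L) = FreeGroup.mk [((0 : Fin 2), e)] * FreeGroup.mk L by
      rw [FreeGroup.mul_mk]; rfl, hl]
    cases e
    · refine ⟨-1 + l, ?_⟩
      rw [zpow_add, zpow_neg_one]; rfl
    · refine ⟨1 + l, ?_⟩
      rw [zpow_add, zpow_one]; rfl

theorem free_key (x : ℝ) (hx : 1 ≤ x) (w : FreeGroup (Fin 2)) (e : SL2R)
    (he : e ∈ Subgroup.zpowers (-1 : SL2R)) (j : ℤ)
    (h : e * FreeGroup.lift ![upp x ^ 2, low x ^ 2] w = upp x ^ j) :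
    ∃ l : ℤ, w = FreeGroup.of 0 ^ l ∧ j = 2 * l := by
  have hw := pp_main x hx w.toWord FreeGroup.isReduced_toWord
  rw [FreeGroup.mk_toWord] at hw
  rw [upp_zpow] at h
  have h10 : ((FreeGroup.lift ![upp x ^ 2, low x ^ 2] w : SL2R) 1 0) = 0 := by
    have := congrArg (fun g : SL2R => g 1 0) h
    rcases negone_zpowers he with rfl | rfl <;> simpa [upp_c] using this
  have hall : ∀ g ∈ w.toWord, g.1 = 0 := by
    rcases hw with h | ⟨e', L', ⟨_, _, h2⟩ | ⟨_, _, h2⟩⟩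
    · exact h.1
    · rw [h10] at h2; simp at h2
    · rw [h10] at h2; simp at h2
  obtain ⟨l, hl⟩ := zpow_of_all_zero _ hall
  rw [FreeGroup.mk_toWord] at hl
  refine ⟨l, hl, ?_⟩
  subst hl
  rw [map_zpow, FreeGroup.lift_apply_of, Matrix.cons_val_zero, pow_two, upp_mul, upp_zpow] at h
  have h0 := congrArg (fun g : SL2R => g 0 0) h
  have h1 := congrArg (fun g : SL2R => g 0 1) h
  rcases negone_zpowers he with rfl | rfl
  · simp [upp_c] at h1
    have : ((2 * l - j : ℤ) : ℝ) * x = 0 := by push_cast; linarith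
    have := (mul_eq_zero.1 this).resolve_right (by linarith)
    have : 2 * l - j = 0 := by exact_mod_cast this
    omega
  · simp [upp_c] at h0
    norm_num at h0

abbrev QQ := SL2R × Multiplicative ℤ

theorem altProd_same {G : Type*} [Monoid G] (u : G) (m : ℕ) : altProd u u m = u ^ m := by
  simp [altProd]

theorem rep2 (n : ℕ) (hn : 3 ≤ n) : ∃ b c : QQ, altProd b c n = altProd c b n ∧
    ∀ (k : ℤ) (w : FreeGroup (Fin 2)) (j : ℤ),
      ((altProd b c n) ^ 2) ^ k * FreeGroup.lift ![b ^ 2, c ^ 2] w = b ^ j →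
      k = 0 ∧ ∃ l : ℤ, w = FreeGroup.of 0 ^ l ∧ j = 2 * l := by
  obtain ⟨x, hx⟩ : ∃ x, x = 2 * Real.cos (Real.pi / n) := ⟨_, rfl⟩
  have hx1 : 1 ≤ x := by
    have : Real.cos (Real.pi / 3) ≤ Real.cos (Real.pi / n) := by
      apply Real.cos_le_cos_of_nonneg_of_le_pi
      · positivity
      · linarith [Real.pi_pos]
      · apply div_le_div_of_nonneg_left Real.pi_pos.le (by norm_num)
        exact_mod_cast hn
    rw [Real.cos_pi_div_three] at this
    linarith
  obtain ⟨hb, hz⟩ := braid_upp_low n hn x hx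
  let t : Multiplicative ℤ := Multiplicative.ofAdd 1
  have f1 : ∀ u v : QQ, (altProd u v n).1 = altProd u.1 v.1 n :=
    fun u v => map_altProd (MonoidHom.fst SL2R (Multiplicative ℤ)) u v n
  have f2 : ∀ u v : QQ, (altProd u v n).2 = altProd u.2 v.2 n :=
    fun u v => map_altProd (MonoidHom.snd SL2R (Multiplicative ℤ)) u v n
  refine ⟨(upp x, t), (low x, t), ?_, ?_⟩
  · apply Prod.ext
    · rw [f1, f1]; exact hb
    · rw [f2, f2]
  · intro k w j h
    have h1 := congrArg Prod.fst h
    have h2 := congrArg Prod.snd h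
    have e1 : (FreeGroup.lift ![((upp x, t) : QQ) ^ 2, (low x, t) ^ 2] w).1 =
        FreeGroup.lift ![upp x ^ 2, low x ^ 2] w := by
      have : (MonoidHom.fst SL2R (Multiplicative ℤ)).comp
          (FreeGroup.lift ![((upp x, t) : QQ) ^ 2, (low x, t) ^ 2]) =
          FreeGroup.lift ![upp x ^ 2, low x ^ 2] := by
        ext i : 1; fin_cases i <;> simp
      exact DFunLike.congr_fun this w
    rw [Prod.fst_mul, Prod.pow_fst, Prod.pow_fst, f1, Prod.pow_fst, e1] at h1
    obtain ⟨l, rfl, rfl⟩ := free_key x hx1 w _ (zpow_mem hz k) j h1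
    refine ⟨?_, l, rfl, rfl⟩
    rw [Prod.snd_mul, Prod.pow_snd, Prod.pow_snd, f2, Prod.pow_snd, altProd_same, map_zpow,
      FreeGroup.lift_apply_of, Matrix.cons_val_zero, Prod.pow_snd, Prod.pow_snd] at h2
    have h3 := congrArg Multiplicative.toAdd h2
    simp [t] at h3
    have h4 : k * (2 * (n : ℤ)) = 0 := by linarith
    rcases mul_eq_zero.1 h4 with h4 | h4 <;> omega

theorem rep1 (m : ℕ) (hm : 2 ≤ m) : ∃ a b : QQ, altProd a b m = altProd b a m ∧
    ∀ (k l : ℤ) (j : ℤ), ((altProd a b m) ^ 2) ^ k * (b ^ 2) ^ l = b ^ j → k = 0 ∧ j = 2 * l := by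
  rcases eq_or_lt_of_le hm with rfl | hm
  · let t : Multiplicative ℤ := Multiplicative.ofAdd 1
    have e : ∀ a b : QQ, altProd a b 2 = a * b := fun a b => by simp [altProd, List.range_succ]
    refine ⟨(1, t), (upp 1, 1), by simp [e], ?_⟩
    intro k l j h
    rw [e] at h
    have h2 := congrArg Prod.snd h
    have h3 := congrArg Multiplicative.toAdd h2
    simp [t] at h3
    subst h3
    have h1 := congrArg Prod.fst h
    simp [pow_two, upp_mul, upp_zpow] at h1
    have h4 := congrArg (fun g : SL2R => g 0 1) h1
    simp [upp_c] at h4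
    refine ⟨rfl, ?_⟩
    have : (l : ℝ) * 2 = j := by linarith
    have : l * 2 = j := by exact_mod_cast this
    omega
  · obtain ⟨b, a, h1, h2⟩ := rep2 m hm
    refine ⟨a, b, h1.symm, ?_⟩
    intro k l j h
    rw [← h1] at h
    obtain ⟨hk, l', hl, hj⟩ := h2 k (FreeGroup.of 0 ^ l) j (by simpa using h)
    refine ⟨hk, ?_⟩
    have h3 := congrArg (FreeGroup.lift (fun _ : Fin 2 => Multiplicative.ofAdd (1 : ℤ))) hl
    have h4 := congrArg Multiplicative.toAdd h3
    simp at h4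
    omega

theorem hh_comm {r : ℕ} {K : Type*} [Group K] (z : K) (v : Fin r → K)
    (hc : ∀ j, Commute z (v j)) (t : Multiplicative ℤ) (w : FreeGroup (Fin r)) :
    Commute (zpowersHom K z t) (FreeGroup.lift v w) := by
  rw [zpowersHom_apply]
  apply Commute.zpow_left
  induction w using FreeGroup.induction_on with
  | C1 => simp
  | of x => simpa using hc x
  | inv_of x h => rw [map_inv]; exact h.inv_right
  | mul x y hx hy => rw [map_mul]; exact hx.mul_right hy

/-- The homomorphism from `ℤ × F_r`. -/
def hh {r : ℕ} {K : Type*} [Group K] (z : K) (v : Fin r → K)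
    (hc : ∀ j, Commute z (v j)) : Multiplicative ℤ × FreeGroup (Fin r) →* K :=
  MonoidHom.noncommCoprod (zpowersHom K z) (FreeGroup.lift v) (hh_comm z v hc)

theorem hh_apply {r : ℕ} {K : Type*} [Group K] (z : K) (v : Fin r → K)
    (hc : ∀ j, Commute z (v j)) (t : Multiplicative ℤ) (w : FreeGroup (Fin r)) :
    hh z v hc (t, w) = z ^ (Multiplicative.toAdd t) * FreeGroup.lift v w := by
  simp [hh]

theorem raag_rel {K : Type*} [Group K] (g : Fin 4 → K) (h01 : Commute (g 0) (g 1))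
    (h12 : Commute (g 1) (g 2)) (h23 : Commute (g 2) (g 3)) :
    ∀ r ∈ raagRels (SimpleGraph.pathGraph 4), FreeGroup.lift g r = 1 := by
  rintro r ⟨u, v, huv, rfl⟩
  have key : Commute (g u) (g v) := by
    rw [SimpleGraph.pathGraph_adj] at huv
    fin_cases u <;> fin_cases v <;> simp at huv <;>
      first | exact h01 | exact h12 | exact h23 | exact h01.symm | exact h12.symm | exact h23.symm
  simp only [map_mul, map_inv, FreeGroup.lift_apply_of]
  rw [key.eq]; group

theorem artin_rel {K : Type*} [Group K] (m n : ℕ) (g : Fin 3 → K)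
    (h01 : altProd (g 0) (g 1) m = altProd (g 1) (g 0) m)
    (h12 : altProd (g 1) (g 2) n = altProd (g 2) (g 1) n) :
    ∀ r ∈ artinRels (SimpleGraph.pathGraph 3) (P3Label m n), FreeGroup.lift g r = 1 := by
  rintro r ⟨u, v, huv, rfl⟩
  rw [map_mul, map_inv, map_altProd, map_altProd, FreeGroup.lift_apply_of, FreeGroup.lift_apply_of,
    mul_inv_eq_one]
  rw [SimpleGraph.pathGraph_adj] at huv
  fin_cases u <;> fin_cases v <;> simp at huv <;> simp [P3Label] <;>
      first | exact h01 | exact h12 | exact h01.symm | exact h12.symm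

theorem raag_comm (u v : Fin 4) (h : (SimpleGraph.pathGraph 4).Adj u v) :
    Commute (PresentedGroup.of u : RAAG (SimpleGraph.pathGraph 4)) (PresentedGroup.of v) := by
  have h1 : PresentedGroup.mk (raagRels (SimpleGraph.pathGraph 4))
      (FreeGroup.of u * FreeGroup.of v * (FreeGroup.of u)⁻¹ * (FreeGroup.of v)⁻¹) = 1 :=
    PresentedGroup.one_of_mem ⟨u, v, h, rfl⟩
  simp only [map_mul, map_inv] at h1
  rw [mul_inv_eq_one, mul_inv_eq_iff_eq_mul] at h1
  exact h1

theorem artin_braid (m n : ℕ) (u v : Fin 3) (h : (SimpleGraph.pathGraph 3).Adj u v) :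
    altProd (PresentedGroup.of u : ArtinGroup (SimpleGraph.pathGraph 3) (P3Label m n))
      (PresentedGroup.of v) (P3Label m n u v) =
    altProd (PresentedGroup.of v) (PresentedGroup.of u) (P3Label m n u v) := by
  have h1 : PresentedGroup.mk (artinRels (SimpleGraph.pathGraph 3) (P3Label m n)) _ = 1 :=
    PresentedGroup.one_of_mem ⟨u, v, h, rfl⟩
  rw [map_mul, map_inv, map_altProd, map_altProd, mul_inv_eq_one] at h1
  exact h1

theorem free_one (w : FreeGroup (Fin 1)) : ∃ l : ℤ, w = FreeGroup.of 0 ^ l := by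
  induction w using FreeGroup.induction_on with
  | C1 => exact ⟨0, rfl⟩
  | of x => exact ⟨1, by rw [zpow_one, Subsingleton.elim x 0]⟩
  | inv_of x h => obtain ⟨l, h⟩ := h; exact ⟨-l, by rw [h, zpow_neg]⟩
  | mul x y hx hy =>
    obtain ⟨l, h⟩ := hx
    obtain ⟨l2, h2⟩ := hy
    exact ⟨l + l2, by rw [h, h2, zpow_add]⟩

/-- The vertex groups `ℤ × F_1` and `ℤ × F_2` of the splitting of `A(P_4)`. -/
abbrev HH (i : Fin 2) : Type := Multiplicative ℤ × FreeGroup (Fin (i.val + 1))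

/-- Edge maps. -/
def phiH (i : Fin 2) : Multiplicative ℤ →* HH i := zpowersHom (HH i) (1, FreeGroup.of 0)

theorem phiH_apply (i : Fin 2) (t : Multiplicative ℤ) :
    phiH i t = (1, FreeGroup.of 0 ^ (Multiplicative.toAdd t)) := by
  simp [phiH, zpowersHom_apply]

theorem phiH_inj (i : Fin 2) : Function.Injective (phiH i) := by
  intro s t h
  rw [phiH_apply, phiH_apply] at h
  have h3 := congrArg (FreeGroup.lift (fun _ : Fin (i.val + 1) => Multiplicative.ofAdd (1 : ℤ)))
    (congrArg Prod.snd h)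
  have h4 := congrArg Multiplicative.toAdd h3
  simpa using h4

/-- Values on the free generators. -/
def vv {K : Type*} (p q : K) (r : ℕ) (j : Fin r) : K := if j.val = 0 then p else q

theorem vv_comm {K : Type*} [Group K] (z0 z1 p q : K) (h0 : Commute z0 p) (h1 : Commute z1 p)
    (h2 : Commute z1 q) (i : Fin 2) (j : Fin (i.val + 1)) :
    Commute (![z0, z1] i) (vv p q _ j) := by
  fin_cases i
  · have : j.val = 0 := Nat.lt_one_iff.1 j.2
    simpa [vv, this] using h0
  · simp only [vv]; split_ifs
    · exact h1
    · exact h2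

abbrev SS := Monoid.PushoutI phiH

theorem ss_comm {i : Fin 2} (x y : HH i) (h : Commute x y) :
    Commute (Monoid.PushoutI.of i x : SS) (Monoid.PushoutI.of i y) := h.map _

/-- The map from the right-angled Artin group to the amalgam. -/
def sigmaFun : Fin 4 → SS :=
  ![Monoid.PushoutI.of 0 (Multiplicative.ofAdd 1, 1),
    Monoid.PushoutI.base phiH (Multiplicative.ofAdd 1),
    Monoid.PushoutI.of 1 (Multiplicative.ofAdd 1, 1),
    Monoid.PushoutI.of 1 (1, FreeGroup.of 1)]

theorem sigma_rel : ∀ r ∈ raagRels (SimpleGraph.pathGraph 4), FreeGroup.lift sigmaFun r = 1 := by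
  apply raag_rel
  · show Commute (Monoid.PushoutI.of 0 _ : SS) (Monoid.PushoutI.base phiH _)
    rw [← Monoid.PushoutI.of_apply_eq_base phiH 0]
    apply ss_comm
    rw [phiH_apply]
    simp [Commute, SemiconjBy]
  · show Commute (Monoid.PushoutI.base phiH _) (Monoid.PushoutI.of 1 _ : SS)
    rw [← Monoid.PushoutI.of_apply_eq_base phiH 1]
    apply ss_comm
    rw [phiH_apply]
    simp [Commute, SemiconjBy]
  · show Commute (Monoid.PushoutI.of 1 _ : SS) (Monoid.PushoutI.of 1 _)
    apply ss_comm
    simp [Commute, SemiconjBy]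

def sigma : RAAG (SimpleGraph.pathGraph 4) →* SS := PresentedGroup.toGroup sigma_rel

theorem sigma_of (i : Fin 4) : sigma (PresentedGroup.of i) = sigmaFun i := PresentedGroup.toGroup.of _

theorem sigma_inj : Function.Injective sigma := by
  let x : Fin 4 → RAAG (SimpleGraph.pathGraph 4) := fun i => PresentedGroup.of i
  have c01 : Commute (x 0) (x 1) := raag_comm 0 1 (by simp [SimpleGraph.pathGraph_adj])
  have c21 : Commute (x 2) (x 1) := raag_comm 2 1 (by simp [SimpleGraph.pathGraph_adj])
  have c23 : Commute (x 2) (x 3) := raag_comm 2 3 (by simp [SimpleGraph.pathGraph_adj])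
  let ρ : SS →* RAAG (SimpleGraph.pathGraph 4) :=
    Monoid.PushoutI.lift (fun i => hh (![x 0, x 2] i) (vv (x 1) (x 3) _)
      (vv_comm _ _ _ _ c01 c21 c23 i)) (zpowersHom _ (x 1)) (by
        intro i
        ext
        simp [phiH_apply, hh_apply, vv])
  have hid : ρ.comp sigma = MonoidHom.id _ := by
    apply PresentedGroup.ext
    intro i
    rw [MonoidHom.comp_apply, sigma_of, MonoidHom.id_apply]
    fin_cases i <;> simp [sigmaFun, ρ, hh_apply, vv, x]
  exact Function.LeftInverse.injective (g := ρ) fun y => DFunLike.congr_fun hid y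

theorem main_inj (m n : ℕ) (hm : 2 ≤ m) (hn : 3 ≤ n)
    (f : RAAG (SimpleGraph.pathGraph 4) →* ArtinGroup (SimpleGraph.pathGraph 3) (P3Label m n))
    (f0 : f (PresentedGroup.of 0) = (altProd (PresentedGroup.of 0) (PresentedGroup.of 1) m) ^ 2)
    (f1 : f (PresentedGroup.of 1) = (PresentedGroup.of 1) ^ 2)
    (f2 : f (PresentedGroup.of 2) = (altProd (PresentedGroup.of 1) (PresentedGroup.of 2) n) ^ 2)
    (f3 : f (PresentedGroup.of 3) = (PresentedGroup.of 2) ^ 2) : Function.Injective f := by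
  obtain ⟨a, b, hab, kab⟩ := rep1 m hm
  obtain ⟨b', c, hbc, kbc⟩ := rep2 n hn
  let G' : Fin 2 → Type := fun _ => QQ
  let φ' : ∀ i : Fin 2, Multiplicative ℤ →* G' i := fun i => zpowersHom QQ (![b, b'] i)
  have hφ' : ∀ i, Function.Injective (φ' i) := by
    intro i
    rw [injective_iff_map_eq_one]
    intro t ht
    have ht' : (![b, b'] i) ^ (Multiplicative.toAdd t) = 1 := ht
    have : Multiplicative.toAdd t = 0 := by
      fin_cases i
      · simpa using (kab 0 0 (Multiplicative.toAdd t) (by simpa using ht'.symm)).2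
      · obtain ⟨_, l, h1, h2⟩ := kbc 0 1 (Multiplicative.toAdd t) (by simpa using ht'.symm)
        have h3 := congrArg (FreeGroup.lift (fun _ : Fin 2 => Multiplicative.ofAdd (1 : ℤ))) h1
        have h4 := congrArg Multiplicative.toAdd h3
        simp at h4
        omega
    simpa using this
  have z0 := (altProd_comm a b m hab).2
  have z1 := (altProd_comm b' c n hbc)
  let ψ : ∀ i, HH i →* G' i := fun i =>
    hh (![(altProd a b m) ^ 2, (altProd b' c n) ^ 2] i) (vv ((![b, b'] i) ^ 2) (c ^ 2) _) (by
      intro j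
      fin_cases i
      · have : j.val = 0 := Nat.lt_one_iff.1 j.2
        simpa [vv, this] using z0.pow_right 2
      · simp only [vv]; split_ifs
        · exact z1.1.pow_right 2
        · exact z1.2.pow_right 2)
  have hinter : ∀ i g, ψ i g ∈ (φ' i).range → g ∈ (phiH i).range := by
    rintro i ⟨t, w⟩ ⟨s, hs⟩
    have hs' : (![(altProd a b m) ^ 2, (altProd b' c n) ^ 2] i) ^ (Multiplicative.toAdd t) *
        FreeGroup.lift (vv ((![b, b'] i) ^ 2) (c ^ 2) _) w =
        (![b, b'] i) ^ (Multiplicative.toAdd s) := by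
      rw [← hh_apply]; exact hs.symm
    suffices h : Multiplicative.toAdd t = 0 ∧ ∃ l : ℤ, w = FreeGroup.of 0 ^ l by
      obtain ⟨ht, l, rfl⟩ := h
      refine ⟨Multiplicative.ofAdd l, ?_⟩
      rw [phiH_apply]
      have : t = 1 := by simpa using ht
      rw [this]; rfl
    clear hs
    fin_cases i
    · obtain ⟨l, hl⟩ := free_one w
      refine ⟨(kab _ l (Multiplicative.toAdd s) ?_).1, l, hl⟩
      rw [hl] at hs'
      simpa [vv] using hs'
    · have hv : vv (b' ^ 2) (c ^ 2) 2 = ![b' ^ 2, c ^ 2] := by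
        funext j; fin_cases j <;> simp [vv]
      obtain ⟨hk, l, hl, _⟩ := kbc (Multiplicative.toAdd t) w (Multiplicative.toAdd s) (by
        rw [← hv]; exact hs')
      exact ⟨hk, l, hl⟩
  let η : Multiplicative ℤ →* Multiplicative ℤ := powMonoidHom 2
  have hη : Function.Injective η := by
    intro x y h
    have h1 := congrArg Multiplicative.toAdd h
    simpa [η] using h1
  let Ψ : SS →* Monoid.PushoutI φ' :=
    Monoid.PushoutI.lift (fun i => (Monoid.PushoutI.of i).comp (ψ i))
      ((Monoid.PushoutI.base φ').comp η) (by
        intro i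
        ext t
        simp only [MonoidHom.comp_apply]
        rw [← Monoid.PushoutI.of_apply_eq_base φ' i]
        congr 1
        simp [phiH_apply, ψ, hh_apply, vv, φ', η])
  have hΨ : Function.Injective Ψ :=
    pushout_map_inj phiH φ' phiH_inj hφ' ψ η hη hinter Ψ
      (fun i g => by simp [Ψ]) (fun h => by simp [Ψ])
  let t : Multiplicative ℤ := Multiplicative.ofAdd 1
  let g : Fin 3 → Monoid.PushoutI φ' :=
    ![Monoid.PushoutI.of (G := G') 0 a, Monoid.PushoutI.base φ' t,
      Monoid.PushoutI.of (G := G') 1 c]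
  have gb0 : g 1 = Monoid.PushoutI.of (G := G') 0 b := by
    show Monoid.PushoutI.base φ' t = _
    rw [← Monoid.PushoutI.of_apply_eq_base φ' 0]
    simp [φ', t]
  have gb1 : g 1 = Monoid.PushoutI.of (G := G') 1 b' := by
    show Monoid.PushoutI.base φ' t = _
    rw [← Monoid.PushoutI.of_apply_eq_base φ' 1]
    simp [φ', t]
  have e0 : altProd (g 0) (g 1) m = Monoid.PushoutI.of (G := G') (φ := φ') 0 (altProd a b m) := by
    rw [gb0, map_altProd]; rfl
  have e1 : altProd (g 1) (g 2) n = Monoid.PushoutI.of (G := G') (φ := φ') 1 (altProd b' c n) := by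
    rw [gb1, map_altProd]; rfl
  have hg : ∀ r ∈ artinRels (SimpleGraph.pathGraph 3) (P3Label m n), FreeGroup.lift g r = 1 := by
    apply artin_rel
    · rw [e0, hab, gb0, map_altProd]; rfl
    · rw [e1, hbc, gb1, map_altProd]; rfl
  let α : ArtinGroup (SimpleGraph.pathGraph 3) (P3Label m n) →* Monoid.PushoutI φ' :=
    PresentedGroup.toGroup hg
  have hα : ∀ i, α (PresentedGroup.of i) = g i := fun i => PresentedGroup.toGroup.of _
  have hcomp : α.comp f = Ψ.comp sigma := by
    apply PresentedGroup.ext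
    intro i
    rw [MonoidHom.comp_apply, MonoidHom.comp_apply, sigma_of]
    fin_cases i
    · show α (f (PresentedGroup.of 0)) = Ψ (sigmaFun 0)
      rw [f0, map_pow, map_altProd, hα, hα, e0, ← map_pow]
      simp [sigmaFun, Ψ, ψ, hh_apply]
    · show α (f (PresentedGroup.of 1)) = Ψ (sigmaFun 1)
      rw [f1, map_pow, hα]
      simp [sigmaFun, Ψ, η, g, t]
    · show α (f (PresentedGroup.of 2)) = Ψ (sigmaFun 2)
      rw [f2, map_pow, map_altProd, hα, hα, e1, ← map_pow]
      simp [sigmaFun, Ψ, ψ, hh_apply]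
    · show α (f (PresentedGroup.of 3)) = Ψ (sigmaFun 3)
      rw [f3, map_pow, hα]
      simp [sigmaFun, Ψ, ψ, hh_apply, vv, g]
  have : Function.Injective (α.comp f) := by
    rw [hcomp]; exact hΨ.comp sigma_inj
  exact Function.Injective.of_comp (f := α) this

/-- For `2 ≤ m ≤ n` with `m + n > 4`, setting `z_{ab} = (a,b)_m` and
`z_{bc} = (b,c)_n` in `A(P₃^{m,n})`, the subgroup generated by `z_{ab}², b², z_{bc}², c²` is
isomorphic to the right-angled Artin group `A(P₄)`, the consecutive path generators of
`A(P₄)` being sent to `z_{ab}², b², z_{bc}², c²` in order; in particular `A(P₄)` embeds into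
`A(P₃^{m,n})`. -/
theorem stmt_10 (m n : ℕ) (hm : 2 ≤ m) (hmn : m ≤ n) (hsum : 4 < m + n)
    (zab zbc : ArtinGroup (SimpleGraph.pathGraph 3) (P3Label m n))
    (hzab : zab = altProd (PresentedGroup.of 0) (PresentedGroup.of 1) m)
    (hzbc : zbc = altProd (PresentedGroup.of 1) (PresentedGroup.of 2) n) :
    ∃ f : RAAG (SimpleGraph.pathGraph 4) →*
        ArtinGroup (SimpleGraph.pathGraph 3) (P3Label m n),
      Function.Injective f ∧
      f (PresentedGroup.of 0) = zab ^ 2 ∧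
      f (PresentedGroup.of 1) = (PresentedGroup.of 1) ^ 2 ∧
      f (PresentedGroup.of 2) = zbc ^ 2 ∧
      f (PresentedGroup.of 3) = (PresentedGroup.of 2) ^ 2 ∧
      f.range = Subgroup.closure
        ({zab ^ 2, (PresentedGroup.of 1) ^ 2, zbc ^ 2, (PresentedGroup.of 2) ^ 2} :
          Set (ArtinGroup (SimpleGraph.pathGraph 3) (P3Label m n))) := by
  subst hzab hzbc
  have h01 : altProd (PresentedGroup.of 0 : ArtinGroup (SimpleGraph.pathGraph 3) (P3Label m n))
      (PresentedGroup.of 1) m = altProd (PresentedGroup.of 1) (PresentedGroup.of 0) m :=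
    artin_braid m n 0 1 (by simp [SimpleGraph.pathGraph_adj])
  have h12 : altProd (PresentedGroup.of 1 : ArtinGroup (SimpleGraph.pathGraph 3) (P3Label m n))
      (PresentedGroup.of 2) n = altProd (PresentedGroup.of 2) (PresentedGroup.of 1) n :=
    artin_braid m n 1 2 (by simp [SimpleGraph.pathGraph_adj])
  have c0 := altProd_comm _ _ _ h01
  have c1 := altProd_comm _ _ _ h12
  let g : Fin 4 → ArtinGroup (SimpleGraph.pathGraph 3) (P3Label m n) :=
    ![(altProd (PresentedGroup.of 0) (PresentedGroup.of 1) m) ^ 2, (PresentedGroup.of 1) ^ 2,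
      (altProd (PresentedGroup.of 1) (PresentedGroup.of 2) n) ^ 2, (PresentedGroup.of 2) ^ 2]
  have hg : ∀ r ∈ raagRels (SimpleGraph.pathGraph 4), FreeGroup.lift g r = 1 :=
    raag_rel g (c0.2.pow_right 2) (c1.1.pow_right 2).symm (c1.2.pow_right 2)
  have hof : ∀ i, PresentedGroup.toGroup hg (PresentedGroup.of i) = g i :=
    fun i => PresentedGroup.toGroup.of _
  refine ⟨PresentedGroup.toGroup hg, main_inj m n hm (by omega) _ (hof 0) (hof 1) (hof 2) (hof 3),
    hof 0, hof 1, hof 2, hof 3, ?_⟩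
  rw [MonoidHom.range_eq_map, ← PresentedGroup.closure_range_of, MonoidHom.map_closure,
    ← Set.range_comp]
  congr 1
  ext y
  simp only [Set.mem_range, Function.comp_apply, hof, Fin.exists_fin_succ, Set.mem_insert_iff,
    Set.mem_singleton_iff]
  simp [g, eq_comm]
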